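/- Let M be a maximum matching in a bipartite graph G. Every maximum matching in G is uniquely restricted if and only if D(M) is acyclic and both induced subgraphs G[V^+(M)] and G[V^-(M)] are forests. -/

import Mathlib

variable {V : Type*}

/-- `M` is a matching in `G`: a set of edges of `G` that are pairwise disjoint. -/
def IsMatchingSet (G : SimpleGraph V) (M : Set (Sym2 V)) : Prop :=
  M ⊆ G.edgeSet ∧ ∀ e ∈ M, ∀ f ∈ M, e ≠ f → ∀ v : V, v ∈ e → v ∉ f

/-- `V(M)`: the set of vertices covered by the matching `M`. -/
def matVerts (M : Set (Sym2 V)) : Set V := {v | ∃ e ∈ M, v ∈ e}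

/-- `M` is a maximum matching in `G`. -/
def IsMaximumMatching (G : SimpleGraph V) (M : Set (Sym2 V)) : Prop :=
  IsMatchingSet G M ∧ ∀ M', IsMatchingSet G M' → M'.ncard ≤ M.ncard

/-- `M` is uniquely restricted: no matching distinct from `M` covers the same vertices. -/
def UniquelyRestricted (G : SimpleGraph V) (M : Set (Sym2 V)) : Prop :=
  ∀ M', IsMatchingSet G M' → matVerts M' = matVerts M → M' = M

/-- `M` is a perfect matching of `G`. -/
def IsPerfectMatchingSet (G : SimpleGraph V) (M : Set (Sym2 V)) : Prop :=
  IsMatchingSet G M ∧ matVerts M = Set.univ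

/-- `A, B` form a bipartition of `G`. -/
def IsBipartition (G : SimpleGraph V) (A B : Set V) : Prop :=
  Disjoint A B ∧ A ∪ B = Set.univ ∧
    ∀ ⦃u v : V⦄, G.Adj u v → (u ∈ A ∧ v ∈ B) ∨ (u ∈ B ∧ v ∈ A)

/-- `I` is an independent set in `G`. -/
def IsIndepSet (G : SimpleGraph V) (I : Set V) : Prop :=
  ∀ u ∈ I, ∀ v ∈ I, ¬ G.Adj u v

/-- `I` is a maximum independent set in `G`. -/
def IsMaximumIndepSet (G : SimpleGraph V) (I : Set V) : Prop :=
  IsIndepSet G I ∧ ∀ J, IsIndepSet G J → J.ncard ≤ I.ncard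

/-- The arcs of the digraph `D(M)`: edges not in `M` oriented from `A` to `B`,
edges of `M` oriented from `B` to `A`. -/
def DMarc (G : SimpleGraph V) (A B : Set V) (M : Set (Sym2 V)) (u v : V) : Prop :=
  G.Adj u v ∧ ((u ∈ A ∧ v ∈ B ∧ s(u, v) ∉ M) ∨ (u ∈ B ∧ v ∈ A ∧ s(u, v) ∈ M))

/-- The digraph `D(M)` is acyclic. -/
def DMAcyclic (G : SimpleGraph V) (A B : Set V) (M : Set (Sym2 V)) : Prop :=
  ∀ v : V, ¬ Relation.TransGen (DMarc G A B M) v v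

/-- `V⁺(M)`: vertices reachable in `D(M)` from an `A`-vertex uncovered by `M`. -/
def Vplus (G : SimpleGraph V) (A B : Set V) (M : Set (Sym2 V)) : Set V :=
  {v | ∃ a ∈ A, a ∉ matVerts M ∧ Relation.ReflTransGen (DMarc G A B M) a v}

/-- `V⁻(M)`: vertices from which a `B`-vertex uncovered by `M` is reachable in `D(M)`. -/
def Vminus (G : SimpleGraph V) (A B : Set V) (M : Set (Sym2 V)) : Set V :=
  {v | ∃ b ∈ B, b ∉ matVerts M ∧ Relation.ReflTransGen (DMarc G A B M) v b}

/-- Given a linear ordering `l` of an independent set, `Mσ G l` is the set of edges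
`y·p(y)` where `p(y)` is the first vertex of `l` adjacent to `y`. -/
def Msigma (G : SimpleGraph V) (l : List V) : Set (Sym2 V) :=
  {e | ∃ (i : Fin l.length) (y : V), e = s(y, l.get i) ∧ G.Adj (l.get i) y ∧
      ∀ j : Fin l.length, (j : ℕ) < (i : ℕ) → ¬ G.Adj (l.get j) y}

/-- `l` is an accessibility ordering of `I`: it enumerates `I` without repetition
and `Mσ` is a matching. -/
def IsAccessibilityOrdering (G : SimpleGraph V) (I : Set V) (l : List V) : Prop :=
  l.Nodup ∧ {v | v ∈ l} = I ∧ IsMatchingSet G (Msigma G l)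

/-- A partial accessibility ordering: an accessibility ordering of a subset of `I`. -/
def IsPartialAccessibilityOrdering (G : SimpleGraph V) (I : Set V) (l : List V) : Prop :=
  l.Nodup ∧ {v | v ∈ l} ⊆ I ∧ IsMatchingSet G (Msigma G l)

/-- `c` is an `M`-alternating cycle: of every two adjacent edges exactly one is in `M`. -/
def IsAlternatingCycle (G : SimpleGraph V) (M : Set (Sym2 V)) {v : V} (c : G.Walk v v) : Prop :=
  c.IsCycle ∧ (c.edges ++ c.edges.take 1).Chain' (fun e f => e ∈ M ↔ f ∉ M)

/-- `M'` arises from `M` by a single edge exchange. -/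
def EdgeExchange (G : SimpleGraph V) (A B : Set V) (M M' : Set (Sym2 V)) : Prop :=
  (∃ a a' b' : V, a ∈ A ∧ a ∉ matVerts M ∧ s(a', b') ∈ M ∧ G.Adj a b' ∧
      M' = (M \ {s(a', b')}) ∪ {s(a, b')}) ∨
  (∃ b a' b' : V, b ∈ B ∧ b ∉ matVerts M ∧ s(a', b') ∈ M ∧ G.Adj a' b ∧
      M' = (M \ {s(a', b')}) ∪ {s(a', b)})

section Arborescence

variable {α β : Type*}

/-- A spanning branching of a bipartite relation `E`: every `b : β` has a parent `p b` and a
child `m b`, distinct elements of `β` have distinct children, and the rank `r` certifies that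
there are no directed cycles. -/
structure IsBranching (E : β → α → Prop) (m p : β → α) (r : α → ℕ) : Prop where
  inj : Function.Injective m
  child : ∀ b, E b (m b)
  parent : ∀ b, E b (p b)
  rank_lt : ∀ b, r (p b) < r (m b)

lemma insert_range_update [DecidableEq β] (m : β → α) (b : β) (a : α) :
    insert (m b) (Set.range (Function.update m b a)) = insert a (Set.range m) := by
  ext z
  simp only [Set.mem_insert_iff, Set.mem_range]
  constructor
  · rintro (rfl | ⟨c, rfl⟩)
    · exact Or.inr ⟨b, rfl⟩
    · by_cases h : c = b
      · subst h; simp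
      · simp [h]
  · rintro (rfl | ⟨c, rfl⟩)
    · exact Or.inr ⟨b, by simp⟩
    · by_cases h : c = b
      · subst h; simp
      · exact Or.inr ⟨c, by simp [h]⟩

lemma injective_update_of_notMem_range [DecidableEq β] {m : β → α} (hm : Function.Injective m)
    (b : β) {a : α} (ha : a ∉ Set.range m) : Function.Injective (Function.update m b a) := by
  intro c d h
  by_cases hc : c = b <;> by_cases hd : d = b <;> simp [hc, hd] at h ⊢
  · exact (ha ⟨d, h.symm⟩).elim
  · exact (ha ⟨c, h⟩).elim
  · exact hm h

lemma notMem_range_update [DecidableEq β] {m : β → α} (hm : Function.Injective m)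
    (b : β) {a : α} (ha : a ∉ Set.range m) : m b ∉ Set.range (Function.update m b a) := by
  rintro ⟨c, hc⟩
  by_cases h : c = b
  · subst h; simp at hc; exact ha ⟨c, hc.symm⟩
  · simp [h] at hc; exact h (hm hc)

/-- A branching can be rerooted at any vertex `x` by reversing the path to `x`. -/
lemma IsBranching.reroot {E : β → α → Prop} {m p : β → α} {r : α → ℕ}
    (h : IsBranching E m p r) (x : α) :
    ∃ m' p' r' y, IsBranching E m' p' r' ∧
      (∀ b, (m' b = m b ∧ p' b = p b) ∨ (m' b = p b ∧ p' b = m b)) ∧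
      y ∉ Set.range m ∧ x ∉ Set.range m' ∧
      insert y (Set.range m) = insert x (Set.range m') := by
  classical
  induction hn : r x using Nat.strong_induction_on generalizing x with
  | _ n ih =>
  by_cases hx : x ∈ Set.range m
  swap
  · exact ⟨m, p, r, x, h, fun b => Or.inl ⟨rfl, rfl⟩, hx, hx, rfl⟩
  obtain ⟨b, rfl⟩ := hx
  obtain ⟨m', p', r', y, h', hsw, hy, hpb, hins⟩ :=
    ih _ (hn ▸ h.rank_lt b) (p b) rfl
  have hmb : m' b = m b ∧ p' b = p b := by
    rcases hsw b with hb | hb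
    · exact hb
    · exact absurd ⟨b, hb.1⟩ hpb
  have hne : p b ≠ m b := fun e => by have := h.rank_lt b; rw [e] at this; omega
  let D : α → Prop := Relation.ReflTransGen (fun z w => ∃ c, z = p' c ∧ w = m' c) (m b)
  have hD0 : D (m b) := Relation.ReflTransGen.refl
  have hDp : ¬ D (p b) := by
    intro hD
    rcases Relation.ReflTransGen.cases_tail hD with e | ⟨z, -, c, -, e⟩
    · exact hne e
    · exact hpb ⟨c, e.symm⟩
  have hDc : ∀ c, c ≠ b → (D (p' c) ↔ D (m' c)) := by
    intro c hc
    constructor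
    · intro hd; exact hd.tail ⟨c, rfl, rfl⟩
    · intro hd
      rcases Relation.ReflTransGen.cases_tail hd with e | ⟨z, hz, d, rfl, e⟩
      · exact absurd (h'.inj (e.trans hmb.1.symm)) hc
      · rwa [h'.inj e]
  refine ⟨Function.update m' b (p b), Function.update p' b (m b),
    fun z => if D z then r' z else r' z + r' (m b) + 1, y,
    ⟨injective_update_of_notMem_range h'.inj b hpb, ?_, ?_, ?_⟩, ?_, hy, ?_, ?_⟩
  · intro c
    by_cases hc : c = b
    · subst hc; simpa using h.parent c
    · simpa [hc] using h'.child c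
  · intro c
    by_cases hc : c = b
    · subst hc; simpa using h.child c
    · simpa [hc] using h'.parent c
  · intro c
    by_cases hc : c = b
    · subst hc; simp [hD0, hDp]
    · have := h'.rank_lt c
      simp only [Function.update_of_ne hc, hDc c hc]
      split_ifs <;> omega
  · intro c
    by_cases hc : c = b
    · subst hc; simp
    · simpa [hc] using hsw c
  · rw [← hmb.1]; exact notMem_range_update h'.inj b hpb
  · rw [hins, ← insert_range_update m' b, hmb.1]

/-- The parent of `b` can be replaced by any root. -/
lemma IsBranching.update_parent [DecidableEq β] {E : β → α → Prop} {m p : β → α} {r : α → ℕ}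
    (h : IsBranching E m p r) {b : β} {a : α} (ha : a ∉ Set.range m) (hE : E b a) :
    ∃ r', IsBranching E m (Function.update p b a) r' := by
  classical
  refine ⟨fun z => if z = a then 0 else r z + 1, h.inj, h.child, ?_, ?_⟩
  · intro c
    by_cases hc : c = b
    · subst hc; simpa using hE
    · simpa [hc] using h.parent c
  · intro c
    have hc' : m c ≠ a := fun e => ha ⟨c, e⟩
    have := h.rank_lt c
    by_cases hc : c = b
    · subst hc; simp [hc']
    · simp only [Function.update_of_ne hc, hc', if_false]
      split_ifs <;> omega

open Classical in
/-- The number of edges of `C` used by the branching with children `m` and parents `p`. -/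
noncomputable def overlap [Fintype β] (C : β → α → Prop) (m p : β → α) : ℕ :=
  ∑ b, ((if C b (m b) then 1 else 0) + (if C b (p b) then 1 else 0))

lemma overlap_congr [Fintype β] {C : β → α → Prop} {m p m' p' : β → α}
    (h : ∀ b, (m' b = m b ∧ p' b = p b) ∨ (m' b = p b ∧ p' b = m b)) :
    overlap C m' p' = overlap C m p := by
  classical
  refine Finset.sum_congr rfl fun b _ => ?_
  rcases h b with ⟨h1, h2⟩ | ⟨h1, h2⟩ <;> rw [h1, h2]
  exact add_comm _ _

lemma overlap_lt_update [Fintype β] [DecidableEq β] {C : β → α → Prop} {m p : β → α} {b : β} {a : α}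
    (hp : ¬ C b (p b)) (ha : C b a) : overlap C m p < overlap C m (Function.update p b a) := by
  classical
  refine Finset.sum_lt_sum (fun c _ => ?_) ⟨b, Finset.mem_univ _, by simp [hp, ha]⟩
  by_cases hc : c = b
  · subst hc; simp [hp]
  · simp [hc]

/-- If matchings of `β` along `E` are determined by their range, then every subrelation `C` of `E`
of degree at most two on `β` is contained in a branching. -/
lemma exists_branching_of_degree_le_two [Finite α] [Fintype β] {E C : β → α → Prop}
    {m p : β → α} {r : α → ℕ} (h : IsBranching E m p r)
    (huniq : ∀ m₁ m₂ : β → α, Function.Injective m₁ → Function.Injective m₂ →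
      (∀ b, E b (m₁ b)) → (∀ b, E b (m₂ b)) → Set.range m₁ = Set.range m₂ → m₁ = m₂)
    (hCE : ∀ b a, C b a → E b a)
    (hC : ∀ b a₁ a₂ a₃, C b a₁ → C b a₂ → C b a₃ → a₁ = a₂ ∨ a₁ = a₃ ∨ a₂ = a₃) :
    ∃ m p r, IsBranching E m p r ∧ ∀ b a, C b a → a = m b ∨ a = p b := by
  classical
  obtain ⟨⟨m, p⟩, ⟨r, h⟩, hmax⟩ := Set.exists_max_image
    {q : (β → α) × (β → α) | ∃ r, IsBranching E q.1 q.2 r} (fun q => overlap C q.1 q.2)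
    (Set.toFinite _) ⟨(m, p), r, h⟩
  refine ⟨m, p, r, h, ?_⟩
  by_contra! hcon
  obtain ⟨b, a, hCa, ham, hap⟩ := hcon
  obtain ⟨m₁, p₁, r₁, -, h₁, hsw₁, -, ha₁, -⟩ := h.reroot a
  obtain ⟨m₂, p₂, r₂, y, h₂, hsw₂, hy, hb₂, hins⟩ := h₁.reroot (m₁ b)
  have ham₁ : a ≠ m₁ b := fun e => ha₁ ⟨b, e.symm⟩
  have hap₁ : a ≠ p₁ b := by
    rcases hsw₁ b with ⟨-, e⟩ | ⟨-, e⟩ <;> rwa [e]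
  have hb : m₂ b = p₁ b ∧ p₂ b = m₁ b := by
    rcases hsw₂ b with ⟨e, -⟩ | e
    · exact absurd ⟨b, e⟩ hb₂
    · exact e
  have ho₁ : overlap C m₁ p₁ = overlap C m p := overlap_congr hsw₁
  have ho₂ : overlap C m₂ p₂ = overlap C m p := (overlap_congr hsw₂).trans ho₁
  by_cases hya : y = a
  · subst hya
    have hE : ∀ c, E c (Function.update m₁ b y c) := by
      intro c
      by_cases hc : c = b
      · subst hc; simpa using hCE _ _ hCa
      · simpa [hc] using h₁.child c
    have hr : Set.range m₂ = Set.range (Function.update m₁ b y) := by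
      have := insert_range_update m₁ b y
      rw [hins] at this
      have hn := notMem_range_update h₁.inj b hy
      ext z
      have hz := Set.ext_iff.1 this z
      simp only [Set.mem_insert_iff] at hz
      by_cases e : z = m₁ b
      · subst e; simp only [hb₂, hn]
      · simpa [e] using hz.symm
    have := huniq _ _ h₂.inj (injective_update_of_notMem_range h₁.inj b hy) h₂.child hE hr
    have := congrFun this b
    rw [hb.1] at this
    simp at this
    exact hap₁ this.symm
  have ha₂ : a ∉ Set.range m₂ := by
    intro hmem
    have : a ∈ insert y (Set.range m₁) := hins ▸ Or.inr hmem
    rcases this with e | e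
    · exact hya e.symm
    · exact ha₁ e
  have hmp : m₁ b ≠ p₁ b := fun e => by have := h₁.rank_lt b; rw [e] at this; omega
  by_cases hCp : C b (p₁ b)
  · have hCm : ¬ C b (p₂ b) := by
      rw [hb.2]
      intro hCm
      rcases hC b _ _ _ hCa hCp hCm with e | e | e
      exacts [hap₁ e, ham₁ e, hmp e.symm]
    obtain ⟨r', h'⟩ := h₂.update_parent ha₂ (hCE _ _ hCa)
    have h1 := hmax (m₂, Function.update p₂ b a) ⟨r', h'⟩
    have h2 := overlap_lt_update (m := m₂) hCm hCa
    simp only at h1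
    omega
  · obtain ⟨r', h'⟩ := h₁.update_parent ha₁ (hCE _ _ hCa)
    have h1 := hmax (m₁, Function.update p₁ b a) ⟨r', h'⟩
    have h2 := overlap_lt_update (m := m₁) hCp hCa
    simp only at h1
    omega

end Arborescence

lemma exists_rank_of_reflTransGen {W : Type*} (R : W → W → Prop) (s : Set W) :
    ∃ r : W → ℕ, ∀ v, (∃ a ∈ s, Relation.ReflTransGen R a v) → v ∈ s ∨
      ∃ u, (∃ a ∈ s, Relation.ReflTransGen R a u) ∧ R u v ∧ r u < r v := by
  let L : ℕ → W → Prop := fun n => Nat.rec (fun v => v ∈ s) (fun _ ih v => ∃ u, ih u ∧ R u v) n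
  have hL : ∀ n v, L n v → ∃ a ∈ s, Relation.ReflTransGen R a v := by
    intro n
    induction n with
    | zero => exact fun v hv => ⟨v, hv, .refl⟩
    | succ n ih =>
      rintro v ⟨u, hu, huv⟩
      obtain ⟨a, ha, hau⟩ := ih u hu
      exact ⟨a, ha, hau.tail huv⟩
  have hL' : ∀ v, (∃ a ∈ s, Relation.ReflTransGen R a v) → ∃ n, L n v := by
    rintro v ⟨a, ha, h⟩
    induction h with
    | refl => exact ⟨0, ha⟩
    | tail _ h ih => obtain ⟨n, hn⟩ := ih; exact ⟨n + 1, _, hn, h⟩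
  refine ⟨fun v => sInf {n | L n v}, fun v hv => ?_⟩
  have hmem : L (sInf {n | L n v}) v := Nat.sInf_mem (hL' v hv)
  rcases hk : sInf {n | L n v} with _ | k
  · rw [hk] at hmem; exact Or.inl hmem
  · rw [hk] at hmem
    obtain ⟨u, hu, huv⟩ := hmem
    exact Or.inr ⟨u, hL _ _ hu, huv, by
      simpa only [hk] using Nat.lt_succ_of_le (Nat.sInf_le hu)⟩

lemma exists_transGen_self_of_forall_exists {W : Type*} [Finite W] (R : W → W → Prop) {s : Set W}
    (hs : s.Nonempty) (h : ∀ v ∈ s, ∃ u ∈ s, Relation.TransGen R v u) :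
    ∃ v, Relation.TransGen R v v := by
  by_contra! hirr
  have : Std.Irrefl (Function.swap (Relation.TransGen R)) := ⟨hirr⟩
  have : IsTrans W (Function.swap (Relation.TransGen R)) := ⟨fun _ _ _ h1 h2 => h2.trans h1⟩
  have hwf := Finite.wellFounded_of_trans_of_irrefl (Function.swap (Relation.TransGen R))
  obtain ⟨v, hv, hmin⟩ := hwf.has_min s hs
  obtain ⟨u, hu, hvu⟩ := h v hv
  exact hmin u hu hvu

namespace SimpleGraph

lemma not_isAcyclic_of_forall_exists_two_adj {W : Type*} [Finite W] {G : SimpleGraph W} {s : Set W}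
    (hs : s.Nonempty) (h : ∀ v ∈ s, ∃ u ∈ s, ∃ w ∈ s, u ≠ w ∧ G.Adj v u ∧ G.Adj v w) :
    ¬ G.IsAcyclic := by
  intro hG
  have := Fintype.ofFinite W
  have key : ∀ n : ℕ, ∃ (u v : W) (p : G.Walk u v), p.IsPath ∧ p.length = n ∧ v ∈ s := by
    intro n
    induction n with
    | zero => exact ⟨_, _, .nil, by simp, rfl, hs.some_mem⟩
    | succ n ih =>
      obtain ⟨u, v, p, hp, hn, hv⟩ := ih
      have : ∃ w ∈ s, w ≠ p.penultimate ∧ G.Adj v w := by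
        obtain ⟨x, hx, y, hy, hxy, hvx, hvy⟩ := h v hv
        by_cases e : x = p.penultimate
        · exact ⟨y, hy, fun e' => hxy (e.trans e'.symm), hvy⟩
        · exact ⟨x, hx, e, hvx⟩
      obtain ⟨w, hw, hne, hvw⟩ := this
      refine ⟨u, w, p.concat hvw, hp.concat (fun hmem => hne ?_) hvw, by simp [hn], hw⟩
      exact hG.eq_penultimate_of_adj_end hp hvw hmem
  obtain ⟨u, v, p, hp, hn, -⟩ := key (Fintype.card W)
  exact absurd hp.length_lt (by omega)

lemma Walk.IsCycle.exists_two_adj_of_rank {W : Type*} {G : SimpleGraph W} {v : W} {c : G.Walk v v}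
    (hc : c.IsCycle) (ρ : W → ℕ) : ∃ x y z, y ≠ z ∧ c.toSubgraph.Adj x y ∧ c.toSubgraph.Adj x z ∧
      ρ y ≤ ρ x ∧ ρ z ≤ ρ x := by
  obtain ⟨x, hx, hmax⟩ := Set.exists_max_image {w | w ∈ c.support} ρ c.support.finite_toSet
    ⟨v, c.start_mem_support⟩
  obtain ⟨y, z, hyz, e⟩ := Set.ncard_eq_two.1 (hc.ncard_neighborSet_toSubgraph_eq_two hx)
  have hy : c.toSubgraph.Adj x y := by
    have : y ∈ c.toSubgraph.neighborSet x := by rw [e]; simp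
    exact this
  have hz : c.toSubgraph.Adj x z := by
    have : z ∈ c.toSubgraph.neighborSet x := by rw [e]; simp
    exact this
  exact ⟨x, y, z, hyz, hy, hz, hmax _ (c.mem_verts_toSubgraph.1 hy.snd_mem),
    hmax _ (c.mem_verts_toSubgraph.1 hz.snd_mem)⟩

lemma Walk.IsCycle.toSubgraph_adj_three {W : Type*} {G : SimpleGraph W} {v : W} {c : G.Walk v v}
    (hc : c.IsCycle) {x y₁ y₂ y₃ : W} (h₁ : c.toSubgraph.Adj x y₁) (h₂ : c.toSubgraph.Adj x y₂)
    (h₃ : c.toSubgraph.Adj x y₃) : y₁ = y₂ ∨ y₁ = y₃ ∨ y₂ = y₃ := by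
  obtain ⟨y, z, -, e⟩ := Set.ncard_eq_two.1
    (hc.ncard_neighborSet_toSubgraph_eq_two (c.mem_verts_toSubgraph.1 h₁.fst_mem))
  have k : ∀ w, c.toSubgraph.Adj x w → w = y ∨ w = z := fun w hw => by
    have : w ∈ c.toSubgraph.neighborSet x := hw
    rwa [e] at this
  grind

end SimpleGraph

section Matching

lemma IsMatchingSet.adj {G : SimpleGraph V} {M : Set (Sym2 V)} (hM : IsMatchingSet G M) {u v : V}
    (h : s(u, v) ∈ M) : G.Adj u v := hM.1 h

lemma IsMatchingSet.mate_unique {G : SimpleGraph V} {M : Set (Sym2 V)} (hM : IsMatchingSet G M)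
    {v u w : V} (hu : s(v, u) ∈ M) (hw : s(v, w) ∈ M) : u = w := by
  by_contra hne
  exact hM.2 _ hu _ hw (fun e => hne (Sym2.congr_right.1 e)) v (by simp) (by simp)

lemma mem_matVerts_iff {M : Set (Sym2 V)} {v : V} : v ∈ matVerts M ↔ ∃ u, s(v, u) ∈ M := by
  constructor
  · rintro ⟨e, he, hv⟩
    obtain ⟨u, rfl⟩ := Sym2.mem_iff_exists.1 hv
    exact ⟨u, he⟩
  · rintro ⟨u, hu⟩
    exact ⟨_, hu, by simp⟩

lemma exists_edge_of_mem_matVerts (M : Set (Sym2 V)) :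
    ∃ f : V → Sym2 V, ∀ v ∈ matVerts M, f v ∈ M ∧ v ∈ f v := by
  have key : ∀ v, ∃ e, v ∈ matVerts M → e ∈ M ∧ v ∈ e := fun v => by
    by_cases hv : v ∈ matVerts M
    · obtain ⟨e, he⟩ := hv
      exact ⟨e, fun _ => he⟩
    · exact ⟨s(v, v), fun h => absurd h hv⟩
  exact Classical.axiom_of_choice key

lemma isMatchingSet_of_mate_unique {G : SimpleGraph V} {M : Set (Sym2 V)}
    (hadj : ∀ u v, s(u, v) ∈ M → G.Adj u v)
    (huniq : ∀ v u w, s(v, u) ∈ M → s(v, w) ∈ M → u = w) : IsMatchingSet G M := by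
  refine ⟨fun e => ?_, fun e he f hf hne v hve hvf => ?_⟩
  · induction e with | _ u v => exact hadj u v
  · obtain ⟨u, rfl⟩ := Sym2.mem_iff_exists.1 hve
    obtain ⟨w, rfl⟩ := Sym2.mem_iff_exists.1 hvf
    exact hne (by rw [huniq v u w he hf])

lemma IsMatchingSet.insert {G : SimpleGraph V} {M : Set (Sym2 V)} (hM : IsMatchingSet G M)
    {x y : V} (hxy : G.Adj x y) (hx : x ∉ matVerts M) (hy : y ∉ matVerts M) :
    IsMatchingSet G (insert s(x, y) M) := by
  have hx' : ∀ z, s(x, z) ∉ M := fun z hz => hx (mem_matVerts_iff.2 ⟨z, hz⟩)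
  have hy' : ∀ z, s(y, z) ∉ M := fun z hz => hy (mem_matVerts_iff.2 ⟨z, hz⟩)
  have hne := hxy.ne
  refine isMatchingSet_of_mate_unique ?_ ?_
  · rintro u v (h | h)
    · rcases Sym2.eq_iff.1 h with ⟨rfl, rfl⟩ | ⟨rfl, rfl⟩
      exacts [hxy, hxy.symm]
    · exact hM.adj h
  · rintro v u w (h | h) (h' | h')
    · rw [Sym2.eq_iff] at h h'; grind
    · rcases Sym2.eq_iff.1 h with ⟨rfl, rfl⟩ | ⟨rfl, rfl⟩
      exacts [(hx' _ h').elim, (hy' _ h').elim]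
    · rcases Sym2.eq_iff.1 h' with ⟨rfl, rfl⟩ | ⟨rfl, rfl⟩
      exacts [(hx' _ h).elim, (hy' _ h).elim]
    · exact hM.mate_unique h h'

variable {G : SimpleGraph V} {A B : Set V} {M : Set (Sym2 V)}

lemma IsBipartition.symm (h : IsBipartition G A B) : IsBipartition G B A :=
  ⟨h.1.symm, by rw [Set.union_comm]; exact h.2.1, fun _ _ huv => (h.2.2 huv).symm⟩

lemma IsBipartition.mem_or (h : IsBipartition G A B) (v : V) : v ∈ A ∨ v ∈ B := by
  have : v ∈ A ∪ B := by rw [h.2.1]; trivial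
  exact this

lemma IsBipartition.notMem_right (h : IsBipartition G A B) {v : V} (hv : v ∈ A) : v ∉ B :=
  fun hb => Set.disjoint_left.1 h.1 hv hb

lemma IsBipartition.mem_right (h : IsBipartition G A B) {u v : V} (huv : G.Adj u v) (hu : u ∈ A) :
    v ∈ B := by
  rcases h.2.2 huv with h' | h'
  exacts [h'.2, absurd h'.1 (h.notMem_right hu)]

lemma IsBipartition.mem_left (h : IsBipartition G A B) {u v : V} (huv : G.Adj u v) (hu : u ∈ B) :
    v ∈ A := h.symm.mem_right huv hu

lemma IsMatchingSet.ncard_eq (hM : IsMatchingSet G M) (h : IsBipartition G A B) :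
    M.ncard = (matVerts M ∩ B).ncard := by
  obtain ⟨f, hfM⟩ := exists_edge_of_mem_matVerts M
  have hf : ∀ v ∈ matVerts M ∩ B, f v ∈ M := fun v hv => (hfM v hv.1).1
  have hvf : ∀ v ∈ matVerts M ∩ B, v ∈ f v := fun v hv => (hfM v hv.1).2
  rw [← Set.InjOn.ncard_image (f := f) (s := matVerts M ∩ B)]
  · congr 1
    ext e
    constructor
    · intro he
      have : ∃ b ∈ e, b ∈ B := by
        induction e with | _ u v =>
        rcases h.2.2 (hM.adj he) with h' | h'
        exacts [⟨v, by simp, h'.2⟩, ⟨u, by simp, h'.1⟩]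
      obtain ⟨b, hbe, hb⟩ := this
      have hb' : b ∈ matVerts M ∩ B := ⟨⟨e, he, hbe⟩, hb⟩
      refine ⟨b, hb', ?_⟩
      by_contra hne
      exact hM.2 _ (hf b hb') _ he hne b (hvf b hb') hbe
    · rintro ⟨b, hb, rfl⟩
      exact hf b hb
  · intro b hb c hc hbc
    by_contra hne
    have h1 := hf b hb
    have h2 := hvf b hb
    have h3 := hvf c hc
    rw [← hbc] at h3
    have e : f b = s(b, c) := (Sym2.mem_and_mem_iff hne).1 ⟨h2, h3⟩
    rw [e] at h1
    exact h.notMem_right (h.mem_left (hM.adj h1) hb.2) hc.2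

lemma IsMaximumMatching.of_ncard_eq (hM : IsMaximumMatching G M) {N : Set (Sym2 V)}
    (hN : IsMatchingSet G N) (h : N.ncard = M.ncard) : IsMaximumMatching G N :=
  ⟨hN, fun M' hM' => h ▸ hM.2 M' hM'⟩

lemma IsMaximumMatching.ncard_eq_ncard (hM : IsMaximumMatching G M) {N : Set (Sym2 V)}
    (hN : IsMaximumMatching G N) : M.ncard = N.ncard :=
  le_antisymm (hN.2 _ hM.1) (hM.2 _ hN.1)

lemma DMarc_swap : DMarc G B A M = Function.swap (DMarc G A B M) := by
  ext u v
  unfold DMarc Function.swap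
  rw [G.adj_comm, Sym2.eq_swap]
  tauto

lemma Vminus_eq_Vplus : Vminus G A B M = Vplus G B A M := by
  ext v
  simp only [Vminus, Vplus, DMarc_swap (A := A) (B := B), Relation.reflTransGen_swap,
    Set.mem_ofPred_eq]

lemma Vplus_of_arc {u v : V} (hu : u ∈ Vplus G A B M) (h : DMarc G A B M u v) :
    v ∈ Vplus G A B M := by
  obtain ⟨a, ha, haM, hau⟩ := hu
  exact ⟨a, ha, haM, hau.tail h⟩

lemma Vplus_of_notMem {a : V} (ha : a ∈ A) (haM : a ∉ matVerts M) : a ∈ Vplus G A B M :=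
  ⟨a, ha, haM, .refl⟩

lemma IsMatchingSet.Vplus_of_mem (hM : IsMatchingSet G M) (h : IsBipartition G A B) {u v : V}
    (hu : u ∈ Vplus G A B M) (huv : s(u, v) ∈ M) : v ∈ Vplus G A B M := by
  rcases h.mem_or u with hA | hB
  · obtain ⟨a, ha, haM, hau⟩ := hu
    rcases Relation.ReflTransGen.cases_tail hau with rfl | ⟨w, haw, hwu⟩
    · exact absurd (mem_matVerts_iff.2 ⟨v, huv⟩) haM
    · rcases hwu.2 with h' | h'
      · exact absurd h'.2.1 (h.notMem_right hA)
      · rw [hM.mate_unique huv (Sym2.eq_swap ▸ h'.2.2)]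
        exact ⟨a, ha, haM, haw⟩
  · exact Vplus_of_arc hu ⟨hM.adj huv, Or.inr ⟨hB, h.mem_left (hM.adj huv) hB, huv⟩⟩

lemma IsMatchingSet.Vplus_of_adj (hM : IsMatchingSet G M) (h : IsBipartition G A B) {u v : V}
    (hu : u ∈ Vplus G A B M) (hA : u ∈ A) (huv : G.Adj u v) : v ∈ Vplus G A B M := by
  by_cases huvM : s(u, v) ∈ M
  · exact hM.Vplus_of_mem h hu huvM
  · exact Vplus_of_arc hu ⟨huv, Or.inl ⟨hA, h.mem_right huv hA, huvM⟩⟩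

/-- The covered `B`-vertices of `V⁺(M)`. -/
abbrev CoveredVplus (G : SimpleGraph V) (A B : Set V) (M : Set (Sym2 V)) : Type _ :=
  {b : V // b ∈ B ∧ b ∈ Vplus G A B M ∧ b ∈ matVerts M}

/-- The edge set obtained from `M` by replacing its part inside `V⁺(M)` by the edges `b m(b)`. -/
def replacePlus (G : SimpleGraph V) (A B : Set V) (M : Set (Sym2 V))
    (m : CoveredVplus G A B M → V) : Set (Sym2 V) :=
  {e | (∃ b : CoveredVplus G A B M, e = s((b : V), m b)) ∨ (e ∈ M ∧ ∀ v ∈ e, v ∉ Vplus G A B M)}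

section replacePlus

variable {m : CoveredVplus G A B M → V}

lemma mk_mem_replacePlus_of_mem {u v : V} (hu : u ∈ Vplus G A B M) :
    s(u, v) ∈ replacePlus G A B M m ↔
      ∃ b : CoveredVplus G A B M, (u = b ∧ v = m b) ∨ (u = m b ∧ v = b) := by
  constructor
  · rintro (⟨b, hb⟩ | ⟨-, h'⟩)
    · exact ⟨b, Sym2.eq_iff.1 hb⟩
    · exact absurd hu (h' u (by simp))
  · rintro ⟨b, hb⟩
    exact Or.inl ⟨b, Sym2.eq_iff.2 hb⟩

lemma mk_mem_replacePlus_of_notMem (hM : IsMatchingSet G M) (h : IsBipartition G A B)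
    (hm : ∀ b, m b ∈ Vplus G A B M) {u v : V} (hu : u ∉ Vplus G A B M) :
    s(u, v) ∈ replacePlus G A B M m ↔ s(u, v) ∈ M := by
  constructor
  · rintro (⟨b, hb⟩ | h')
    · rcases Sym2.eq_iff.1 hb with ⟨rfl, -⟩ | ⟨rfl, -⟩
      exacts [absurd b.2.2.1 hu, absurd (hm b) hu]
    · exact h'.1
  · intro huv
    refine Or.inr ⟨huv, fun w hw hwP => ?_⟩
    rcases Sym2.mem_iff.1 hw with rfl | rfl
    · exact hu hwP
    · exact hu (hM.Vplus_of_mem h hwP (Sym2.eq_swap ▸ huv))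

lemma isMatchingSet_replacePlus (hM : IsMatchingSet G M) (h : IsBipartition G A B)
    (hinj : Function.Injective m) (hm : ∀ b, m b ∈ Vplus G A B M) (hadj : ∀ b, G.Adj b.1 (m b)) :
    IsMatchingSet G (replacePlus G A B M m) := by
  have hmB : ∀ b, m b ∉ B := fun b => h.notMem_right (h.mem_left (hadj b) b.2.1)
  refine isMatchingSet_of_mate_unique ?_ ?_
  · rintro u v (⟨b, hb⟩ | h')
    · rcases Sym2.eq_iff.1 hb with ⟨rfl, rfl⟩ | ⟨rfl, rfl⟩
      exacts [hadj b, (hadj b).symm]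
    · exact hM.adj h'.1
  · intro v u w hu hw
    by_cases hv : v ∈ Vplus G A B M
    · rw [mk_mem_replacePlus_of_mem hv] at hu hw
      obtain ⟨b, ⟨rfl, rfl⟩ | ⟨rfl, rfl⟩⟩ := hu <;> obtain ⟨c, ⟨h1, rfl⟩ | ⟨h1, rfl⟩⟩ := hw
      · rw [Subtype.ext h1]
      · exact absurd (h1 ▸ b.2.1) (hmB c)
      · exact absurd (h1 ▸ c.2.1) (hmB b)
      · rw [hinj h1]
    · rw [mk_mem_replacePlus_of_notMem hM h hm hv] at hu hw
      exact hM.mate_unique hu hw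

lemma mem_matVerts_replacePlus {v : V} (hv : v ∈ Vplus G A B M) :
    v ∈ matVerts (replacePlus G A B M m) ↔
      (v ∈ B ∧ v ∈ matVerts M) ∨ v ∈ Set.range m := by
  rw [mem_matVerts_iff]
  simp only [mk_mem_replacePlus_of_mem hv]
  constructor
  · rintro ⟨u, b, ⟨rfl, -⟩ | ⟨rfl, -⟩⟩
    exacts [Or.inl ⟨b.2.1, b.2.2.2⟩, Or.inr ⟨b, rfl⟩]
  · rintro (⟨h1, h2⟩ | ⟨b, rfl⟩)
    exacts [⟨_, ⟨v, h1, hv, h2⟩, Or.inl ⟨rfl, rfl⟩⟩, ⟨_, b, Or.inr ⟨rfl, rfl⟩⟩]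

lemma mem_matVerts_replacePlus_of_notMem (hM : IsMatchingSet G M) (h : IsBipartition G A B)
    (hm : ∀ b, m b ∈ Vplus G A B M) {v : V} (hv : v ∉ Vplus G A B M) :
    v ∈ matVerts (replacePlus G A B M m) ↔ v ∈ matVerts M := by
  simp only [mem_matVerts_iff, mk_mem_replacePlus_of_notMem hM h hm hv]

lemma ncard_replacePlus (hM : IsMatchingSet G M) (h : IsBipartition G A B)
    (hinj : Function.Injective m) (hm : ∀ b, m b ∈ Vplus G A B M) (hadj : ∀ b, G.Adj b.1 (m b)) :
    (replacePlus G A B M m).ncard = M.ncard := by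
  have hmB : ∀ b, m b ∉ B := fun b => h.notMem_right (h.mem_left (hadj b) b.2.1)
  rw [(isMatchingSet_replacePlus hM h hinj hm hadj).ncard_eq h, hM.ncard_eq h]
  congr 1
  ext v
  simp only [Set.mem_inter_iff, and_congr_left_iff]
  intro hv
  by_cases hvP : v ∈ Vplus G A B M
  · rw [mem_matVerts_replacePlus hvP]
    have : v ∉ Set.range m := by rintro ⟨b, rfl⟩; exact hmB b hv
    tauto
  · exact mem_matVerts_replacePlus_of_notMem hM h hm hvP

end replacePlus

lemma IsMatchingSet.exists_isBranching (hM : IsMatchingSet G M) (h : IsBipartition G A B) :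
    ∃ (m p : CoveredVplus G A B M → V) (r : V → ℕ),
      IsBranching (fun b a => G.Adj b.1 a ∧ a ∈ Vplus G A B M) m p r := by
  obtain ⟨r, hr⟩ := exists_rank_of_reflTransGen (DMarc G A B M) {a | a ∈ A ∧ a ∉ matVerts M}
  simp only [Set.mem_ofPred_eq, and_assoc] at hr
  have hmate : ∀ b : CoveredVplus G A B M, ∃ a, s((b : V), a) ∈ M :=
    fun b => mem_matVerts_iff.1 b.2.2.2
  have hpar : ∀ b : CoveredVplus G A B M, ∃ u ∈ Vplus G A B M, G.Adj b.1 u ∧ r u < r b.1 := by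
    intro b
    rcases hr b b.2.2.1 with h1 | ⟨u, hu, hub, hlt⟩
    · exact absurd b.2.1 (h.notMem_right h1.1)
    · exact ⟨u, hu, hub.1.symm, hlt⟩
  choose m hm using hmate
  choose p hpP hpadj hpr using hpar
  refine ⟨m, p, r, fun b c hbc => ?_, fun b => ⟨hM.adj (hm b), ?_⟩,
    fun b => ⟨hpadj b, hpP b⟩, fun b => (hpr b).trans ?_⟩
  · have h1 := hm b
    have h2 := hm c
    rw [hbc] at h1
    rw [Sym2.eq_swap] at h1 h2
    exact Subtype.ext (hM.mate_unique h1 h2)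
  · exact hM.Vplus_of_mem h b.2.2.1 (hm b)
  · have hA : m b ∈ A := h.mem_left (hM.adj (hm b)) b.2.1
    have hsw : s(m b, (b : V)) ∈ M := Sym2.eq_swap ▸ hm b
    rcases hr (m b) (hM.Vplus_of_mem h b.2.2.1 (hm b)) with h1 | ⟨u, hu, hub, hlt⟩
    · exact absurd (mem_matVerts_iff.2 ⟨_, hsw⟩) h1.2
    · rcases hub.2 with h₁ | h₁
      · exact absurd h₁.2.1 (h.notMem_right hA)
      · rwa [hM.mate_unique hsw (Sym2.eq_swap ▸ h₁.2.2)]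

/-- No `M`-augmenting path: the `B`-vertices of `V⁺(M)` are covered. -/
lemma IsMaximumMatching.covered_Vplus [Finite V] (hM : IsMaximumMatching G M)
    (h : IsBipartition G A B) {b : V} (hb : b ∈ B) (hbP : b ∈ Vplus G A B M) :
    b ∈ matVerts M := by
  by_contra hbM
  obtain ⟨a, haP, hab⟩ : ∃ a ∈ Vplus G A B M, G.Adj a b := by
    obtain ⟨a, ha, haM, hab⟩ := hbP
    rcases Relation.ReflTransGen.cases_tail hab with rfl | ⟨w, haw, hwb⟩
    · exact absurd hb (h.notMem_right ha)
    · exact ⟨w, ⟨a, ha, haM, haw⟩, hwb.1⟩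
  have haA : a ∈ A := h.mem_left hab.symm hb
  obtain ⟨m, p, r, hmpr⟩ := hM.1.exists_isBranching h
  obtain ⟨m', p', r', -, h', -, -, ha, -⟩ := hmpr.reroot a
  have hN := isMatchingSet_replacePlus hM.1 h h'.inj (fun b => (h'.child b).2)
    (fun b => (h'.child b).1)
  have hc := ncard_replacePlus hM.1 h h'.inj (fun b => (h'.child b).2) (fun b => (h'.child b).1)
  have ha' : a ∉ matVerts (replacePlus G A B M m') := by
    rw [mem_matVerts_replacePlus haP]
    have := h.notMem_right haA
    tauto
  have hb' : b ∉ matVerts (replacePlus G A B M m') := by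
    rw [mem_matVerts_replacePlus hbP]
    rintro (h1 | ⟨c, rfl⟩)
    · exact hbM h1.2
    · exact h.notMem_right (h.mem_left (h'.child c).1 c.2.1) hb
  have := hM.2 _ (hN.insert hab ha' hb')
  rw [Set.ncard_insert_of_notMem (fun hmem => ha' (mem_matVerts_iff.2 ⟨b, hmem⟩)), hc] at this
  omega

/-- The vertex cover dual to a maximum matching is covered by every maximum matching, and meets
each of its edges exactly once. -/
lemma IsMaximumMatching.cover [Finite V] (hM : IsMaximumMatching G M) (h : IsBipartition G A B)
    {N : Set (Sym2 V)} (hN : IsMaximumMatching G N) :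
    (∀ b ∈ B, b ∈ Vplus G A B M → b ∈ matVerts N) ∧
    (∀ a ∈ A, a ∉ Vplus G A B M → a ∈ matVerts N) ∧
    (∀ u v, s(u, v) ∈ N → u ∈ Vplus G A B M → v ∈ Vplus G A B M) := by
  let K : Set V := {v | (v ∈ B ∧ v ∈ Vplus G A B M) ∨ (v ∈ A ∧ v ∉ Vplus G A B M)}
  have hKM : K ⊆ matVerts M := by
    rintro v (⟨h1, h2⟩ | ⟨h1, h2⟩)
    · exact hM.covered_Vplus h h1 h2
    · by_contra h3
      exact h2 (Vplus_of_notMem h1 h3)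
  have hcov : ∀ e ∈ N, ∃ v ∈ e, v ∈ K := by
    have aux : ∀ u v, G.Adj u v → u ∈ A → u ∈ K ∨ v ∈ K := by
      intro u v huv hu
      by_cases huP : u ∈ Vplus G A B M
      · exact Or.inr (Or.inl ⟨h.mem_right huv hu, hM.1.Vplus_of_adj h huP hu huv⟩)
      · exact Or.inl (Or.inr ⟨hu, huP⟩)
    intro e he
    induction e with | _ u v =>
    have huv := hN.1.adj he
    rcases h.mem_or u with hu | hu
    · rcases aux u v huv hu with k | k
      exacts [⟨u, by simp, k⟩, ⟨v, by simp, k⟩]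
    · rcases aux v u huv.symm (h.mem_left huv hu) with k | k
      exacts [⟨v, by simp, k⟩, ⟨u, by simp, k⟩]
  have hKcard : K.ncard ≤ M.ncard := by
    obtain ⟨f, hfM⟩ := exists_edge_of_mem_matVerts M
    have hf : ∀ v ∈ K, f v ∈ M := fun v hv => (hfM v (hKM hv)).1
    have hvf : ∀ v ∈ K, v ∈ f v := fun v hv => (hfM v (hKM hv)).2
    refine Set.ncard_le_ncard_of_injOn f hf ?_
    intro b hb c hc hbc
    by_contra hne
    have h1 := hf b hb
    have h3 := hvf c hc
    rw [← hbc] at h3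
    have e : f b = s(b, c) := (Sym2.mem_and_mem_iff hne).1 ⟨hvf b hb, h3⟩
    rw [e] at h1
    have h1' : s(c, b) ∈ M := Sym2.eq_swap ▸ h1
    rcases hb with ⟨hb1, hb2⟩ | ⟨hb1, hb2⟩ <;> rcases hc with ⟨hc1, hc2⟩ | ⟨hc1, hc2⟩
    · exact h.notMem_right (h.mem_left (hM.1.adj h1) hb1) hc1
    · exact hc2 (hM.1.Vplus_of_mem h hb2 h1)
    · exact hb2 (hM.1.Vplus_of_mem h hc2 h1')
    · exact h.notMem_right hc1 (h.mem_right (hM.1.adj h1) hb1)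
  obtain ⟨f, hfN⟩ := exists_edge_of_mem_matVerts N
  have hf : ∀ v ∈ matVerts N, f v ∈ N := fun v hv => (hfN v hv).1
  have hvf : ∀ v ∈ matVerts N, v ∈ f v := fun v hv => (hfN v hv).2
  have himg : f '' (K ∩ matVerts N) = N := by
    ext e
    constructor
    · rintro ⟨v, hv, rfl⟩
      exact hf v hv.2
    · intro he
      obtain ⟨v, hve, hv⟩ := hcov e he
      have hvN : v ∈ matVerts N := ⟨e, he, hve⟩
      refine ⟨v, ⟨hv, hvN⟩, ?_⟩
      by_contra hne
      exact hN.1.2 _ (hf v hvN) _ he hne v (hvf v hvN) hve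
  have hcard := hM.ncard_eq_ncard hN
  have h1 : N.ncard ≤ (K ∩ matVerts N).ncard := by
    conv_lhs => rw [← himg]
    exact Set.ncard_image_le
  have h2 : (K ∩ matVerts N).ncard ≤ K.ncard := Set.ncard_le_ncard Set.inter_subset_left
  have hKN : K ∩ matVerts N = K :=
    Set.eq_of_subset_of_ncard_le Set.inter_subset_left (by omega)
  have hinj : Set.InjOn f (K ∩ matVerts N) :=
    Set.injOn_of_ncard_image_eq (by rw [himg]; omega)
  have hK : K ⊆ matVerts N := Set.inter_eq_left.1 hKN
  have hone : ∀ u v, s(u, v) ∈ N → u ∈ K → v ∉ K := by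
    intro u v huv hu hv
    refine (hN.1.adj huv).ne (hinj ⟨hu, hK hu⟩ ⟨hv, hK hv⟩ ?_)
    have e : ∀ w ∈ s(u, v), w ∈ K → f w = s(u, v) := by
      intro w hw hwK
      by_contra hne
      exact hN.1.2 _ (hf w (hK hwK)) _ huv hne w (hvf w (hK hwK)) hw
    rw [e u (by simp) hu, e v (by simp) hv]
  refine ⟨fun b h1 h2 => hK (Or.inl ⟨h1, h2⟩), fun a h1 h2 => hK (Or.inr ⟨h1, h2⟩), ?_⟩
  intro u v huv hu
  have hadj := hN.1.adj huv
  rcases h.mem_or u with hA | hB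
  · exact hM.1.Vplus_of_adj h hu hA hadj
  · by_contra hv
    exact hone u v huv (Or.inl ⟨hB, hu⟩) (Or.inr ⟨h.mem_left hadj hB, hv⟩)

lemma not_uniquelyRestricted_of_bijOn (hM : IsMatchingSet G M) (h : IsBipartition G A B)
    {P : Set V} (hP : P.Nonempty) (hPA : P ⊆ A) {f g : V → V} (hf : f '' P = P)
    (hinj : Set.InjOn f P) (hadj : ∀ a ∈ P, G.Adj a (g a)) (hnot : ∀ a ∈ P, s(a, g a) ∉ M)
    (hmem : ∀ a ∈ P, s(g a, f a) ∈ M) : ¬ UniquelyRestricted G M := by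
  intro hU
  have hgB : ∀ a ∈ P, g a ∈ B := fun a ha => h.mem_right (hadj a ha) (hPA ha)
  have hPB : ∀ a ∈ P, a ∉ B := fun a ha => h.notMem_right (hPA ha)
  have hfP : ∀ a ∈ P, f a ∈ P := fun a ha => hf ▸ Set.mem_image_of_mem f ha
  have hpre : ∀ a ∈ P, ∃ a' ∈ P, s(a, g a') ∈ M := by
    intro a ha
    rw [← hf] at ha
    obtain ⟨a', ha', rfl⟩ := ha
    exact ⟨a', ha', Sym2.eq_swap ▸ hmem a' ha'⟩
  have hginj : ∀ a ∈ P, ∀ a' ∈ P, g a = g a' → a = a' := by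
    intro a ha a' ha' e
    have h1 := hmem a ha
    rw [e] at h1
    exact hinj ha ha' (hM.mate_unique h1 (hmem a' ha'))
  let N : Set (Sym2 V) := {e | (∃ a ∈ P, e = s(a, g a)) ∨ (e ∈ M ∧ ∀ v ∈ e, v ∉ P)}
  have hNP : ∀ u v, u ∈ P → (s(u, v) ∈ N ↔ v = g u) := by
    intro u v hu
    constructor
    · rintro (⟨a, ha, e⟩ | ⟨-, hno⟩)
      · rcases Sym2.eq_iff.1 e with ⟨rfl, rfl⟩ | ⟨rfl, rfl⟩
        exacts [rfl, absurd (hgB _ ha) (hPB _ hu)]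
      · exact absurd hu (hno u (by simp))
    · rintro rfl
      exact Or.inl ⟨u, hu, rfl⟩
  have hNg : ∀ a v, a ∈ P → (s(g a, v) ∈ N ↔ v = a) := by
    intro a v ha
    constructor
    · rintro (⟨a', ha', e⟩ | ⟨hm, hno⟩)
      · rcases Sym2.eq_iff.1 e with ⟨e1, e2⟩ | ⟨e1, e2⟩
        · exact absurd (e1 ▸ hgB _ ha) (hPB _ ha')
        · rw [e2]; exact hginj _ ha' _ ha e1.symm
      · have := hM.mate_unique hm (hmem a ha)
        exact absurd (hfP a ha) (this ▸ hno v (by simp))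
    · rintro rfl
      exact Or.inl ⟨v, ha, Sym2.eq_swap⟩
  have hNo : ∀ u v, u ∉ P → (∀ a ∈ P, u ≠ g a) → (s(u, v) ∈ N ↔ s(u, v) ∈ M) := by
    intro u v hu hug
    constructor
    · rintro (⟨a, ha, e⟩ | ⟨hm, -⟩)
      · rcases Sym2.eq_iff.1 e with ⟨rfl, rfl⟩ | ⟨rfl, rfl⟩
        exacts [absurd ha hu, absurd rfl (hug _ ha)]
      · exact hm
    · intro hm
      refine Or.inr ⟨hm, fun w hw hwP => ?_⟩
      rcases Sym2.mem_iff.1 hw with rfl | rfl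
      · exact hu hwP
      · obtain ⟨a', ha', hma⟩ := hpre w hwP
        exact hug a' ha' (hM.mate_unique (Sym2.eq_swap ▸ hm) hma)
  have hN : IsMatchingSet G N := by
    refine isMatchingSet_of_mate_unique ?_ ?_
    · rintro u v (⟨a, ha, e⟩ | ⟨hm, -⟩)
      · rcases Sym2.eq_iff.1 e with ⟨rfl, rfl⟩ | ⟨rfl, rfl⟩
        exacts [hadj _ ha, (hadj _ ha).symm]
      · exact hM.adj hm
    · intro v u w hu hw
      by_cases hv : v ∈ P
      · rw [hNP _ _ hv] at hu hw; rw [hu, hw]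
      by_cases hvg : ∃ a ∈ P, v = g a
      · obtain ⟨a, ha, rfl⟩ := hvg
        rw [hNg _ _ ha] at hu hw; rw [hu, hw]
      · push Not at hvg
        rw [hNo _ _ hv hvg] at hu hw
        exact hM.mate_unique hu hw
  have hcov : matVerts N = matVerts M := by
    ext v
    by_cases hv : v ∈ P
    · obtain ⟨a', -, hm⟩ := hpre v hv
      exact iff_of_true (mem_matVerts_iff.2 ⟨_, (hNP _ _ hv).2 rfl⟩) (mem_matVerts_iff.2 ⟨_, hm⟩)
    by_cases hvg : ∃ a ∈ P, v = g a
    · obtain ⟨a, ha, rfl⟩ := hvg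
      exact iff_of_true (mem_matVerts_iff.2 ⟨_, (hNg _ _ ha).2 rfl⟩)
        (mem_matVerts_iff.2 ⟨_, hmem a ha⟩)
    · push Not at hvg
      simp only [mem_matVerts_iff, hNo _ _ hv hvg]
  obtain ⟨a, ha⟩ := hP
  have : s(a, g a) ∈ N := Or.inl ⟨a, ha, rfl⟩
  rw [hU N hN hcov] at this
  exact hnot a ha this

lemma exists_nonempty_image_eq_self [Finite V] {f : V → V} {s : Set V} (hs : s.Nonempty)
    (hf : Set.MapsTo f s s) : ∃ P ⊆ s, P.Nonempty ∧ f '' P = P := by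
  obtain ⟨P, ⟨hPs, hP, hfP⟩, hmin⟩ := exists_minimal_of_wellFoundedLT
    (fun P : Set V => P ⊆ s ∧ P.Nonempty ∧ Set.MapsTo f P P) ⟨s, subset_rfl, hs, hf⟩
  have hsub : f '' P ⊆ P := hfP.image_subset
  refine ⟨P, hPs, hP, hsub.antisymm (hmin ⟨hsub.trans hPs, hP.image f, ?_⟩ hsub)⟩
  exact fun x hx => Set.mem_image_of_mem f (hsub hx)

lemma IsMatchingSet.dmAcyclic [Finite V] (hM : IsMatchingSet G M) (h : IsBipartition G A B)
    (hU : UniquelyRestricted G M) : DMAcyclic G A B M := by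
  intro v hv
  have hstep : ∀ a, a ∈ A ∧ Relation.TransGen (DMarc G A B M) a a → ∃ b a', G.Adj a b ∧
      s(a, b) ∉ M ∧ s(b, a') ∈ M ∧ a' ∈ A ∧ Relation.TransGen (DMarc G A B M) a' a' := by
    rintro a ⟨ha, haa⟩
    obtain ⟨b, hab, hba⟩ := Relation.TransGen.head'_iff.1 haa
    rcases hab.2 with ⟨-, hb, habM⟩ | h'
    swap
    · exact absurd h'.1 (h.notMem_right ha)
    rcases Relation.ReflTransGen.cases_head hba with rfl | ⟨a', hba', ha'a⟩
    · exact absurd hb (h.notMem_right ha)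
    rcases hba'.2 with h' | ⟨-, ha', hM'⟩
    · exact absurd hb (h.notMem_right h'.1)
    · exact ⟨b, a', hab.1, habM, hM', ha', (Relation.TransGen.tail' ha'a hab).tail hba'⟩
  have hne : {a | a ∈ A ∧ Relation.TransGen (DMarc G A B M) a a}.Nonempty := by
    rcases h.mem_or v with hA | hB
    · exact ⟨v, hA, hv⟩
    · obtain ⟨w, hvw, hwv⟩ := Relation.TransGen.head'_iff.1 hv
      exact ⟨w, h.mem_left hvw.1 hB, Relation.TransGen.tail' hwv hvw⟩
  have : Nonempty V := ⟨v⟩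
  choose! g f hadj hnot hmem hA hT using hstep
  obtain ⟨P, hPs, hP, hfP⟩ := exists_nonempty_image_eq_self (f := f) hne
    fun a ha => ⟨hA a ha, hT a ha⟩
  exact not_uniquelyRestricted_of_bijOn hM h hP (fun a ha => (hPs ha).1) hfP
    (Set.injOn_of_ncard_image_eq (by rw [hfP])) (fun a ha => hadj a (hPs ha))
    (fun a ha => hnot a (hPs ha)) (fun a ha => hmem a (hPs ha)) hU

lemma IsMaximumMatching.isAcyclic_induce_Vplus [Finite V] (hM : IsMaximumMatching G M)
    (h : IsBipartition G A B) (hU : ∀ M', IsMaximumMatching G M' → UniquelyRestricted G M') :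
    (G.induce (Vplus G A B M)).IsAcyclic := by
  intro v₀ c₀ hc₀
  have := Fintype.ofFinite (CoveredVplus G A B M)
  let ι := (SimpleGraph.Embedding.induce (G := G) (Vplus G A B M)).toHom
  have hc : (c₀.map ι).IsCycle := hc₀.map Subtype.val_injective
  set c := c₀.map ι
  have hcP : ∀ u w, c.toSubgraph.Adj u w → u ∈ Vplus G A B M := by
    intro u w huw
    have hu := c.mem_verts_toSubgraph.1 huw.fst_mem
    rw [SimpleGraph.Walk.support_map, List.mem_map] at hu
    obtain ⟨x, -, rfl⟩ := hu
    exact x.2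
  have huniq : ∀ m₁ m₂ : CoveredVplus G A B M → V, Function.Injective m₁ →
      Function.Injective m₂ → (∀ b, G.Adj b.1 (m₁ b) ∧ m₁ b ∈ Vplus G A B M) →
      (∀ b, G.Adj b.1 (m₂ b) ∧ m₂ b ∈ Vplus G A B M) → Set.range m₁ = Set.range m₂ → m₁ = m₂ := by
    intro m₁ m₂ hi₁ hi₂ hE₁ hE₂ hr
    have hP₁ := fun b => (hE₁ b).2
    have hP₂ := fun b => (hE₂ b).2
    have hN₁ := isMatchingSet_replacePlus hM.1 h hi₁ hP₁ fun b => (hE₁ b).1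
    have hN₂ := isMatchingSet_replacePlus hM.1 h hi₂ hP₂ fun b => (hE₂ b).1
    have hmax := hM.of_ncard_eq hN₁ (ncard_replacePlus hM.1 h hi₁ hP₁ fun b => (hE₁ b).1)
    have heq := hU _ hmax _ hN₂ <| by
      ext v
      by_cases hv : v ∈ Vplus G A B M
      · rw [mem_matVerts_replacePlus hv, mem_matVerts_replacePlus hv, hr]
      · rw [mem_matVerts_replacePlus_of_notMem hM.1 h hP₁ hv,
          mem_matVerts_replacePlus_of_notMem hM.1 h hP₂ hv]
    funext b
    have hb : s(b.1, m₂ b) ∈ replacePlus G A B M m₂ := Or.inl ⟨b, rfl⟩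
    rw [heq] at hb
    exact hN₁.mate_unique (Or.inl ⟨b, rfl⟩) hb
  obtain ⟨m, p, r, hmpr⟩ := hM.1.exists_isBranching h
  obtain ⟨m, p, r, hmpr, hC⟩ := exists_branching_of_degree_le_two
    (C := fun (b : CoveredVplus G A B M) a => c.toSubgraph.Adj b.1 a) hmpr huniq
    (fun b a hba => ⟨hba.adj_sub, hcP _ _ hba.symm⟩)
    fun _ _ _ _ h₁ h₂ h₃ => hc.toSubgraph_adj_three h₁ h₂ h₃
  classical
  obtain ⟨x, y, z, hyz, hxy, hxz, hy, hz⟩ := hc.exists_two_adj_of_rank fun v =>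
    if hv : v ∈ B ∧ v ∈ Vplus G A B M ∧ v ∈ matVerts M then 2 * r (m ⟨v, hv⟩) - 1 else 2 * r v
  have hcov : ∀ b w, c.toSubgraph.Adj b w → b ∈ B →
      b ∈ B ∧ b ∈ Vplus G A B M ∧ b ∈ matVerts M :=
    fun b w hbw hb => ⟨hb, hcP _ _ hbw, hM.covered_Vplus h hb (hcP _ _ hbw)⟩
  have hmA : ∀ b, m b ∉ B := fun b => h.notMem_right (h.mem_left (hmpr.child b).1 b.2.1)
  rcases h.mem_or x with hxA | hxB
  · have hx := h.notMem_right hxA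
    have aux : ∀ w, c.toSubgraph.Adj x w →
        (∀ hw : w ∈ B ∧ w ∈ Vplus G A B M ∧ w ∈ matVerts M,
          2 * r (m ⟨w, hw⟩) - 1 ≤ 2 * r x → x = m ⟨w, hw⟩) := by
      intro w hxw hw hle
      rcases hC ⟨w, hw⟩ x hxw.symm with e | e
      · exact e
      · have := hmpr.rank_lt ⟨w, hw⟩
        rw [← e] at this
        omega
    have hyB := hcov y x hxy.symm (h.mem_right hxy.adj_sub hxA)
    have hzB := hcov z x hxz.symm (h.mem_right hxz.adj_sub hxA)
    rw [dif_pos hyB, dif_neg fun k => hx k.1] at hy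
    rw [dif_pos hzB, dif_neg fun k => hx k.1] at hz
    have := hmpr.inj ((aux y hxy hyB hy).symm.trans (aux z hxz hzB hz))
    exact hyz (congrArg Subtype.val this)
  · have hx := hcov x y hxy hxB
    have aux : ∀ w, c.toSubgraph.Adj x w →
        2 * r w ≤ 2 * r (m ⟨x, hx⟩) - 1 → w = p ⟨x, hx⟩ := by
      intro w hxw hle
      rcases hC ⟨x, hx⟩ w hxw with e | e
      · have := hmpr.rank_lt ⟨x, hx⟩
        rw [e] at hle
        omega
      · exact e
    have hyA := h.notMem_right (h.mem_left hxy.adj_sub hxB)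
    have hzA := h.notMem_right (h.mem_left hxz.adj_sub hxB)
    rw [dif_neg fun k => hyA k.1, dif_pos hx] at hy
    rw [dif_neg fun k => hzA k.1, dif_pos hx] at hz
    exact hyz ((aux y hxy hy).trans (aux z hxz hz).symm)

lemma IsMatchingSet.exists_ne_of_ne {X Y : Set (Sym2 V)} (hY : IsMatchingSet G Y) {v u w : V}
    (hu : s(v, u) ∈ X) (hw : s(v, w) ∈ Y) (hne : u ≠ w) (huY : u ∈ matVerts Y) :
    ∃ x, v ≠ x ∧ s(u, v) ∈ X ∧ s(u, x) ∈ Y := by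
  obtain ⟨x, hx⟩ := mem_matVerts_iff.1 huY
  refine ⟨x, ?_, Sym2.eq_swap ▸ hu, hx⟩
  rintro rfl
  exact hne (hY.mate_unique (Sym2.eq_swap ▸ hx) hw)

/-- Two matchings covering the same vertices agree on the vertices of an induced forest that their
edges do not leave. -/
lemma mate_eq_of_isAcyclic_induce [Finite V] {N N' : Set (Sym2 V)} (hN : IsMatchingSet G N)
    (hN' : IsMatchingSet G N') (hcov : matVerts N = matVerts N') {P : Set V}
    (hP : (G.induce P).IsAcyclic) (hNP : ∀ u v, s(u, v) ∈ N → u ∈ P → v ∈ P)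
    (hNP' : ∀ u v, s(u, v) ∈ N' → u ∈ P → v ∈ P) {v u w : V} (hv : v ∈ P)
    (hu : s(v, u) ∈ N) (hw : s(v, w) ∈ N') : u = w := by
  by_contra hne
  refine SimpleGraph.not_isAcyclic_of_forall_exists_two_adj
    (s := {x : P | ∃ y z, y ≠ z ∧ s(x.1, y) ∈ N ∧ s(x.1, z) ∈ N'}) ⟨⟨v, hv⟩, u, w, hne, hu, hw⟩
    ?_ hP
  rintro ⟨x, hx⟩ ⟨y, z, hyz, hy, hz⟩
  have hyc : y ∈ matVerts N' := hcov ▸ mem_matVerts_iff.2 ⟨x, Sym2.eq_swap ▸ hy⟩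
  have hzc : z ∈ matVerts N := hcov ▸ mem_matVerts_iff.2 ⟨x, Sym2.eq_swap ▸ hz⟩
  obtain ⟨y', h1, h2, h3⟩ := hN'.exists_ne_of_ne hy hz hyz hyc
  obtain ⟨z', h4, h5, h6⟩ := hN.exists_ne_of_ne hz hy hyz.symm hzc
  exact ⟨⟨y, hNP _ _ hy hx⟩, ⟨x, y', h1, h2, h3⟩, ⟨z, hNP' _ _ hz hx⟩,
    ⟨z', x, h4.symm, h6, h5⟩, fun e => hyz (congrArg Subtype.val e), hN.adj hy, hN'.adj hz⟩

/-- If `D(M)` is acyclic, every maximum matching agrees with `M` outside `V⁺(M) ∪ V⁻(M)`. -/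
lemma IsMaximumMatching.mate_eq_of_dmAcyclic [Finite V] (hM : IsMaximumMatching G M)
    (h : IsBipartition G A B) (hD : DMAcyclic G A B M) {N : Set (Sym2 V)}
    (hN : IsMaximumMatching G N) {v u w : V} (hvp : v ∉ Vplus G A B M) (hvm : v ∉ Vplus G B A M)
    (hu : s(v, u) ∈ M) (hw : s(v, w) ∈ N) : u = w := by
  have out : ∀ {X}, IsMaximumMatching G X → ∀ x y, s(x, y) ∈ X →
      x ∉ Vplus G A B M ∧ x ∉ Vplus G B A M → y ∉ Vplus G A B M ∧ y ∉ Vplus G B A M := by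
    intro X hX x y hxy hx
    have hyx : s(y, x) ∈ X := Sym2.eq_swap ▸ hxy
    exact ⟨fun hy => hx.1 ((hM.cover h hX).2.2 _ _ hyx hy),
      fun hy => hx.2 ((hM.cover h.symm hX).2.2 _ _ hyx hy)⟩
  have cov : ∀ {X}, IsMaximumMatching G X → ∀ x,
      x ∉ Vplus G A B M ∧ x ∉ Vplus G B A M → x ∈ matVerts X := by
    intro X hX x hx
    rcases h.mem_or x with hA | hB
    · exact (hM.cover h hX).2.1 x hA hx.1
    · exact (hM.cover h.symm hX).2.1 x hB hx.2
  by_contra hne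
  let S : Set V := {x | x ∈ A ∧ (x ∉ Vplus G A B M ∧ x ∉ Vplus G B A M) ∧
    ∃ y z, y ≠ z ∧ s(x, y) ∈ M ∧ s(x, z) ∈ N}
  have hS : S.Nonempty := by
    rcases h.mem_or v with hA | hB
    · exact ⟨v, hA, ⟨hvp, hvm⟩, u, w, hne, hu, hw⟩
    · have huo := out hM v u hu ⟨hvp, hvm⟩
      obtain ⟨x, h1, h2, h3⟩ := hN.1.exists_ne_of_ne hu hw hne (cov hN u huo)
      exact ⟨u, h.mem_left (hM.1.adj hu) hB, huo, v, x, h1, h2, h3⟩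
  obtain ⟨x, hx⟩ := exists_transGen_self_of_forall_exists (DMarc G A B M) hS <| by
    rintro x ⟨hxA, hxo, y, z, hyz, hy, hz⟩
    have hzo := out hN x z hz hxo
    obtain ⟨x', h1, h2, h3⟩ := hM.1.exists_ne_of_ne hz hy hyz.symm (cov hM z hzo)
    have hxo' := out hM z x' h3 hzo
    obtain ⟨z', h4, h5, h6⟩ := hN.1.exists_ne_of_ne h3 h2 h1.symm (cov hN x' hxo')
    have hzB := h.mem_right (hN.1.adj hz) hxA
    have hxA' := h.mem_left (hM.1.adj h3) hzB
    refine ⟨x', ⟨hxA', hxo', z, z', h4, h5, h6⟩, .head ⟨hN.1.adj hz, Or.inl ⟨hxA, hzB, ?_⟩⟩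
      (.single ⟨hM.1.adj h3, Or.inr ⟨hzB, hxA', h3⟩⟩)⟩
    exact fun hzM => hyz (hM.1.mate_unique hy hzM)
  exact hD x hx

lemma subset_of_forall_mate_eq {N N' : Set (Sym2 V)} (hcov : matVerts N ⊆ matVerts N')
    (huniq : ∀ v u w, s(v, u) ∈ N → s(v, w) ∈ N' → u = w) : N ⊆ N' := by
  intro e he
  induction e with | _ v u =>
  obtain ⟨w, hw⟩ := mem_matVerts_iff.1 (hcov (mem_matVerts_iff.2 ⟨u, he⟩))
  rwa [huniq v u w he hw]

end Matching

/-- Every maximum matching of the bipartite graph `G` is uniquely restricted iff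
`D(M)` is acyclic and `G[V⁺(M)]` and `G[V⁻(M)]` are forests. -/
theorem stmt13 [Fintype V] (G : SimpleGraph V) (A B : Set V) (hbip : IsBipartition G A B)
    (M : Set (Sym2 V)) (hM : IsMaximumMatching G M) :
    (∀ M', IsMaximumMatching G M' → UniquelyRestricted G M') ↔
      (DMAcyclic G A B M ∧ (G.induce (Vplus G A B M)).IsAcyclic ∧
        (G.induce (Vminus G A B M)).IsAcyclic) := by
  constructor
  · intro hU
    refine ⟨hM.1.dmAcyclic hbip (hU M hM), hM.isAcyclic_induce_Vplus hbip hU, ?_⟩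
    rw [Vminus_eq_Vplus]
    exact hM.isAcyclic_induce_Vplus hbip.symm hU
  · rintro ⟨hD, hp, hm⟩ M' hM' N hN hcov
    rw [Vminus_eq_Vplus] at hm
    have hNmax : IsMaximumMatching G N :=
      hM'.of_ncard_eq hN (by rw [hN.ncard_eq hbip, hM'.1.ncard_eq hbip, hcov])
    have key : ∀ v u w, s(v, u) ∈ N → s(v, w) ∈ M' → u = w := by
      intro v u w hu hw
      by_cases hvp : v ∈ Vplus G A B M
      · exact mate_eq_of_isAcyclic_induce hN hM'.1 hcov hp (hM.cover hbip hNmax).2.2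
          (hM.cover hbip hM').2.2 hvp hu hw
      by_cases hvm : v ∈ Vplus G B A M
      · exact mate_eq_of_isAcyclic_induce hN hM'.1 hcov hm (hM.cover hbip.symm hNmax).2.2
          (hM.cover hbip.symm hM').2.2 hvm hu hw
      have hv : v ∈ matVerts M := by
        rcases hbip.mem_or v with hA | hB
        · exact (hM.cover hbip hM).2.1 v hA hvp
        · exact (hM.cover hbip.symm hM).2.1 v hB hvm
      obtain ⟨x, hx⟩ := mem_matVerts_iff.1 hv
      exact (hM.mate_eq_of_dmAcyclic hbip hD hNmax hvp hvm hx hu).symm.trans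
        (hM.mate_eq_of_dmAcyclic hbip hD hM' hvp hvm hx hw)
    exact (subset_of_forall_mate_eq hcov.subset key).antisymm
      (subset_of_forall_mate_eq hcov.superset fun v u w hu hw => (key v w u hw hu).symm)
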